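/- Let n ≥ 5 and let G be the graph obtained from a star-like construction: a vertex w₃ whose neighborhood in a complete bipartite graph K_{a,b} (parts X, Y with |X|·? ...) Precisely: let G consist of K_{X,Y} (complete bipartite on parts X,Y) together with a triangle w₁w₂w₃, where w₁ is joined to all of X \ X₁, w₂ to all of Y \ Y₁, and w₃ to all of X₁ ∪ Y₁, with X₁ ⊆ X, Y₁ ⊆ Y. If |X₁|·|Y₁| ≤ 1, then G is θ(1,2,2)-free (i.e., contains no K₄ minus a perfect matching... i.e., no two triangles sharing an edge / no 'diamond' with an extra path—formally no subgraph isomorphic to θ(1,2,2) = K₄ minus one edge plus... = the graph of two vertices joined by paths of lengths 1, 2, 2, which is K₄ minus an edge). -/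

import Mathlib

open Finset SimpleGraph
open scoped Classical

/-- `θ(1,2,2)`: two adjacent vertices with two common neighbors, i.e. `K₄` minus one
edge (the "diamond"). Here vertices `0` and `1` are the branch vertices and the edge
`{2,3}` is missing. -/
def diamond : SimpleGraph (Fin 4) := (⊤ : SimpleGraph (Fin 4)).deleteEdges {s(2, 3)}

/-- A member of the family `𝒢(n)`: the complete bipartite graph on parts `X`, `Y`,
together with a triangle `w₁w₂w₃`, where `w₁` is joined to `X \ X₁`, `w₂` to `Y \ Y₁`,
and `w₃` to `X₁ ∪ Y₁`. -/
def gFam {X Y : Type*} (X₁ : Finset X) (Y₁ : Finset Y) : SimpleGraph (X ⊕ (Y ⊕ Fin 3)) :=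
  SimpleGraph.fromRel (fun u v =>
    (∃ (x : X) (y : Y), u = Sum.inl x ∧ v = Sum.inr (Sum.inl y)) ∨
    (∃ x : X, x ∉ X₁ ∧ u = Sum.inl x ∧ v = Sum.inr (Sum.inr 0)) ∨
    (∃ y : Y, y ∉ Y₁ ∧ u = Sum.inr (Sum.inl y) ∧ v = Sum.inr (Sum.inr 1)) ∨
    (∃ x : X, x ∈ X₁ ∧ u = Sum.inl x ∧ v = Sum.inr (Sum.inr 2)) ∨
    (∃ y : Y, y ∈ Y₁ ∧ u = Sum.inr (Sum.inl y) ∧ v = Sum.inr (Sum.inr 2)) ∨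
    (∃ (s t : Fin 3), s ≠ t ∧ u = Sum.inr (Sum.inr s) ∧ v = Sum.inr (Sum.inr t)))

theorem Finset.eq_of_mem_of_card_mul_card_le_one {α β : Type*} {s : Finset α} {t : Finset β}
    (h : s.card * t.card ≤ 1) {a : α} (ha : a ∈ s) {b b' : β} (hb : b ∈ t) (hb' : b' ∈ t) :
    b = b' := by
  have hs : 0 < s.card := Finset.card_pos.mpr ⟨a, ha⟩
  exact Finset.card_le_one.mp (by nlinarith) b hb b' hb'

section gFam

variable {X Y : Type*} {X₁ : Finset X} {Y₁ : Finset Y}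

/-- Away from `w₃`, the graph `gFam X₁ Y₁` is bipartite with parts `X ∪ {w₂}` and `Y ∪ {w₁}`,
so every triangle passes through `w₃`. -/
theorem gFam_triangle {a b c : X ⊕ (Y ⊕ Fin 3)} (hab : (gFam X₁ Y₁).Adj a b)
    (hac : (gFam X₁ Y₁).Adj a c) (hbc : (gFam X₁ Y₁).Adj b c) :
    a = .inr (.inr 2) ∨ b = .inr (.inr 2) ∨ c = .inr (.inr 2) := by
  rcases a with a | a | a <;> rcases b with b | b | b <;> rcases c with c | c | c <;>
    simp [gFam] at hab hac hbc ⊢ <;> grind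

theorem gFam_adj_w₃ {a : X ⊕ (Y ⊕ Fin 3)} (ha : (gFam X₁ Y₁).Adj (.inr (.inr 2)) a) :
    (∃ x ∈ X₁, a = .inl x) ∨ (∃ y ∈ Y₁, a = .inr (.inl y)) ∨
      a = .inr (.inr 0) ∨ a = .inr (.inr 1) := by
  rcases a with a | a | a <;> simp [gFam] at ha ⊢ <;> grind

/-- If `|X₁| * |Y₁| ≤ 1`, then the neighborhood of `w₃` contains no path on three vertices. -/
theorem gFam_eq_of_adj_of_adj (h : X₁.card * Y₁.card ≤ 1) {a b c : X ⊕ (Y ⊕ Fin 3)}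
    (ha : (gFam X₁ Y₁).Adj (.inr (.inr 2)) a) (hb : (gFam X₁ Y₁).Adj (.inr (.inr 2)) b)
    (hc : (gFam X₁ Y₁).Adj (.inr (.inr 2)) c) (hab : (gFam X₁ Y₁).Adj a b)
    (hac : (gFam X₁ Y₁).Adj a c) : b = c := by
  have hY {x : X} (hx : x ∈ X₁) {y y' : Y} (hy : y ∈ Y₁) (hy' : y' ∈ Y₁) : y = y' :=
    Finset.eq_of_mem_of_card_mul_card_le_one h hx hy hy'
  have hX {y : Y} (hy : y ∈ Y₁) {x x' : X} (hx : x ∈ X₁) (hx' : x' ∈ X₁) : x = x' :=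
    Finset.eq_of_mem_of_card_mul_card_le_one (mul_comm X₁.card _ ▸ h) hy hx hx'
  rcases gFam_adj_w₃ ha with ⟨x, hx, rfl⟩ | ⟨y, hy, rfl⟩ | rfl | rfl <;>
    rcases gFam_adj_w₃ hb with ⟨x', hx', rfl⟩ | ⟨y', hy', rfl⟩ | rfl | rfl <;>
    simp [gFam, *] at hab <;>
    rcases gFam_adj_w₃ hc with ⟨x'', hx'', rfl⟩ | ⟨y'', hy'', rfl⟩ | rfl | rfl <;>
    simp [gFam, *] at hac ⊢
  · exact hY hx hy' hy''
  · exact hX hy hx' hx''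

end gFam

/-- If `|X₁| · |Y₁| ≤ 1`, then the graph of the family `𝒢(n)` is `θ(1,2,2)`-free
(contains no subgraph isomorphic to the diamond `K₄` minus an edge). -/
theorem stmt14 {X Y : Type*} (X₁ : Finset X) (Y₁ : Finset Y)
    (h : X₁.card * Y₁.card ≤ 1) :
    ¬ ∃ f : diamond →g gFam X₁ Y₁, Function.Injective f := by
  rintro ⟨f, hf⟩
  have adj {i j : Fin 4} (hij : diamond.Adj i j) : (gFam X₁ Y₁).Adj (f i) (f j) := f.map_adj hij
  have h01 : (gFam X₁ Y₁).Adj (f 0) (f 1) := adj (by simp [diamond])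
  have h02 : (gFam X₁ Y₁).Adj (f 0) (f 2) := adj (by simp [diamond])
  have h03 : (gFam X₁ Y₁).Adj (f 0) (f 3) := adj (by simp [diamond])
  have h12 : (gFam X₁ Y₁).Adj (f 1) (f 2) := adj (by simp [diamond])
  have h13 : (gFam X₁ Y₁).Adj (f 1) (f 3) := adj (by simp [diamond])
  have h23 : f 2 ≠ f 3 := hf.ne (by decide)
  have hw0 : f 0 ≠ .inr (.inr 2) := fun e =>
    h23 (gFam_eq_of_adj_of_adj h (e ▸ h01) (e ▸ h02) (e ▸ h03) h12 h13)
  have hw1 : f 1 ≠ .inr (.inr 2) := fun e =>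
    h23 (gFam_eq_of_adj_of_adj h (e ▸ h01.symm) (e ▸ h12) (e ▸ h13) h02 h03)
  have hw2 := ((gFam_triangle h01 h02 h12).resolve_left hw0).resolve_left hw1
  have hw3 := ((gFam_triangle h01 h03 h13).resolve_left hw0).resolve_left hw1
  exact h23 (hw2.trans hw3.symm)
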